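/- Let a ∈ ℝ and β, η, ν > 0 with η² < 2βν. Let h : ℝ → ℝ be bounded, nonnegative, non-decreasing on [a, c) and non-increasing on (c, ∞) for some c with a ≤ c ≤ ∞, and suppose the limit λ = lim_{x→∞} H(x)/x² exists and is finite. Then the optimal value of the worst-case tail problem with parameters (a, β, η, ν) equals max_{x₁ ∈ [0, μ]} W(x₁). -/

import Mathlib

open MeasureTheory Set Filter Topology

/-- The right derivative of `f` at `x`: the derivative within `(x, ∞)`. -/
noncomputable def rightDeriv (f : ℝ → ℝ) (x : ℝ) : ℝ := derivWithin f (Set.Ioi x) x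

/-- The right derivative of `f` exists at `x`. -/
def HasRightDerivAt (f : ℝ → ℝ) (x : ℝ) : Prop := ∃ d : ℝ, HasDerivWithinAt f d (Set.Ioi x) x

/-- `f` is feasible for the worst-case tail problem with parameters `(a, β, η, ν)`. -/
def Feasible (a β η ν : ℝ) (f : ℝ → ℝ) : Prop :=
  IntegrableOn f (Set.Ioi a) ∧
  (∫ x in Set.Ioi a, f x) = β ∧
  f a = η ∧
  ContinuousWithinAt f (Set.Ici a) a ∧
  HasRightDerivAt f a ∧
  -ν ≤ rightDeriv f a ∧
  ConvexOn ℝ (Set.Ici a) f ∧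
  (∀ x, a ≤ x → 0 ≤ f x)

/-- `H(x) = ∫₀ˣ ∫₀ᵘ h(v + a) dv du`. -/
noncomputable def Hfun (a : ℝ) (h : ℝ → ℝ) (x : ℝ) : ℝ :=
  ∫ u in (0:ℝ)..x, (∫ v in (0:ℝ)..u, h (v + a))

/-- The line-search objective `W(x₁)` (with `W(μ) = ν(H(μ) + λ(σ − μ²))`). -/
noncomputable def Wfun (a ν μ σ lam : ℝ) (h : ℝ → ℝ) (x₁ : ℝ) : ℝ :=
  if x₁ = μ then ν * (Hfun a h μ + lam * (σ - μ ^ 2))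
  else ν * ((σ - μ ^ 2) / (σ - 2 * μ * x₁ + x₁ ^ 2) * Hfun a h x₁ +
    (μ - x₁) ^ 2 / (σ - 2 * μ * x₁ + x₁ ^ 2) * Hfun a h ((σ - μ * x₁) / (μ - x₁)))



noncomputable def PP (g : ℝ → ℝ) (x : ℝ) : ℝ := ∫ v in (0:ℝ)..x, g v
noncomputable def HH (g : ℝ → ℝ) (x : ℝ) : ℝ := ∫ u in (0:ℝ)..x, PP g u

lemma Hfun_eq (a : ℝ) (h : ℝ → ℝ) (x : ℝ) : Hfun a h x = HH (fun v => h (v + a)) x := rfl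

lemma HH_zero (g : ℝ → ℝ) : HH g 0 = 0 := by simp [HH]

/-- basic assumptions -/
structure BM (g : ℝ → ℝ) (M : ℝ) : Prop where
  meas : Measurable g
  nn : ∀ x, 0 ≤ g x
  le : ∀ x, g x ≤ M

lemma BM.ii {g M} (hg : BM g M) (x y : ℝ) : IntervalIntegrable g volume x y := by
  refine (intervalIntegrable_const (c := M)).mono_fun hg.meas.aestronglyMeasurable ?_
  refine Eventually.of_forall fun v => ?_
  show ‖g v‖ ≤ ‖M‖
  rw [Real.norm_eq_abs, Real.norm_eq_abs, abs_of_nonneg (hg.nn v)]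
  exact (hg.le v).trans (le_abs_self M)

lemma BM.PP_sub {g M} (hg : BM g M) (x y : ℝ) : PP g y - PP g x = ∫ v in x..y, g v :=
  intervalIntegral.integral_interval_sub_left (hg.ii _ _) (hg.ii _ _)

lemma BM.PP_cont {g M} (hg : BM g M) : Continuous (PP g) :=
  intervalIntegral.continuous_primitive (fun x y => hg.ii x y) 0

lemma BM.PP_mono {g M} (hg : BM g M) {x y : ℝ} (hxy : x ≤ y) : 0 ≤ PP g y - PP g x := by
  rw [hg.PP_sub]
  exact intervalIntegral.integral_nonneg hxy (fun v _ => hg.nn v)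

lemma BM.PP_lip {g M} (hg : BM g M) {x y : ℝ} (hxy : x ≤ y) : PP g y - PP g x ≤ M * (y - x) := by
  rw [hg.PP_sub]
  have := intervalIntegral.integral_mono_on hxy (hg.ii x y) (intervalIntegrable_const (c := M))
    (fun v _ => hg.le v)
  simpa [mul_comm] using this

lemma BM.HH_deriv {g M} (hg : BM g M) (x : ℝ) : HasDerivAt (HH g) (PP g x) x :=
  intervalIntegral.integral_hasDerivAt_right (hg.PP_cont.intervalIntegrable _ _)
    hg.PP_cont.aestronglyMeasurable.stronglyMeasurableAtFilter hg.PP_cont.continuousAt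

lemma BM.HH_cont {g M} (hg : BM g M) : Continuous (HH g) :=
  continuous_iff_continuousAt.2 fun x => (hg.HH_deriv x).continuousAt

/-- strict quasi-concavity on the positive half line -/
def SQ (g : ℝ → ℝ) : Prop := ∀ u v w, 0 < u → u < v → v < w → min (g u) (g w) < g v

lemma BM.exists_ge {g M} (hg : BM g M) {x y κ : ℝ} (hxy : x < y)
    (h : κ * (y - x) ≤ PP g y - PP g x) : ∃ v, x < v ∧ v < y ∧ κ ≤ g v := by
  by_contra! hc
  have := intervalIntegral.intervalIntegral_pos_of_pos_on
    (f := fun v => κ - g v) (intervalIntegrable_const.sub (hg.ii x y))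
    (fun v hv => by have := hc v hv.1 hv.2; linarith) hxy
  rw [intervalIntegral.integral_sub intervalIntegrable_const (hg.ii x y), ← hg.PP_sub] at this
  simp at this
  linarith

lemma BM.exists_le {g M} (hg : BM g M) {x y κ : ℝ} (hxy : x < y)
    (h : PP g y - PP g x ≤ κ * (y - x)) : ∃ v, x < v ∧ v < y ∧ g v ≤ κ := by
  by_contra! hc
  have := intervalIntegral.intervalIntegral_pos_of_pos_on
    (f := fun v => g v - κ) ((hg.ii x y).sub intervalIntegrable_const)
    (fun v hv => by have := hc v hv.1 hv.2; linarith) hxy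
  rw [intervalIntegral.integral_sub (hg.ii x y) intervalIntegrable_const, ← hg.PP_sub] at this
  simp at this
  linarith

/-- no alternating sign pattern for `P` minus a linear function -/
lemma BM.noPattern {g M} (hg : BM g M) (hs : SQ g) (α κ : ℝ) {x y z w : ℝ} (hx : 0 ≤ x)
    (hxy : x < y) (hyz : y < z) (hzw : z < w)
    (h1 : PP g x - (α + κ * x) ≤ 0) (h2 : 0 ≤ PP g y - (α + κ * y))
    (h3 : PP g z - (α + κ * z) ≤ 0) (h4 : 0 ≤ PP g w - (α + κ * w)) : False := by
  obtain ⟨u, hu1, hu2, hu⟩ := hg.exists_ge (κ := κ) hxy (by linarith)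
  obtain ⟨v, hv1, hv2, hv⟩ := hg.exists_le (κ := κ) hyz (by linarith)
  obtain ⟨t, ht1, ht2, ht⟩ := hg.exists_ge (κ := κ) hzw (by linarith)
  have := hs u v t (by linarith) (by linarith) (by linarith)
  exact absurd this (not_lt.2 (le_min (hv.trans hu) (hv.trans ht)))

lemma BM.D_deriv {g M} (hg : BM g M) (z1 z2 z3 u : ℝ) :
    HasDerivAt (fun x => HH g x - (z1 + z2 * x + z3 * x ^ 2)) (PP g u - (z2 + (2 * z3) * u)) u := by
  have h1 : HasDerivAt (fun x : ℝ => z1 + z2 * x + z3 * x ^ 2) (z2 + (2 * z3) * u) u := by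
    have h2 := ((hasDerivAt_id u).const_mul z2).const_add z1
    have h3 := (hasDerivAt_pow 2 u).const_mul z3
    refine (h2.add h3).congr_deriv ?_
    simp
    ring
  exact (hg.HH_deriv u).sub h1

/-- mean value theorem for `D = H - q`. -/
lemma BM.mvt {g M} (hg : BM g M) (z1 z2 z3 : ℝ) {x y : ℝ} (hxy : x < y) :
    ∃ u, x < u ∧ u < y ∧
      (HH g y - (z1 + z2 * y + z3 * y ^ 2)) - (HH g x - (z1 + z2 * x + z3 * x ^ 2))
        = (PP g u - (z2 + (2 * z3) * u)) * (y - x) := by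
  have hd := hg.D_deriv z1 z2 z3
  obtain ⟨u, hu, he⟩ := exists_hasDerivAt_eq_slope _ _ hxy
    (fun t _ => (hd t).continuousAt.continuousWithinAt) (fun t _ => hd t)
  refine ⟨u, hu.1, hu.2, ?_⟩
  rw [he]
  field_simp [sub_ne_zero.2 hxy.ne']

lemma BM.mvt_pos {g M} (hg : BM g M) (z1 z2 z3 : ℝ) {x y : ℝ} (hxy : x < y)
    (h : HH g x - (z1 + z2 * x + z3 * x ^ 2) ≤ HH g y - (z1 + z2 * y + z3 * y ^ 2)) :
    ∃ u, x < u ∧ u < y ∧ 0 ≤ PP g u - (z2 + (2 * z3) * u) := by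
  obtain ⟨u, h1, h2, h3⟩ := hg.mvt z1 z2 z3 hxy
  refine ⟨u, h1, h2, ?_⟩
  by_contra! hc
  have := mul_neg_of_neg_of_pos hc (sub_pos.2 hxy)
  linarith

lemma BM.mvt_neg {g M} (hg : BM g M) (z1 z2 z3 : ℝ) {x y : ℝ} (hxy : x < y)
    (h : HH g y - (z1 + z2 * y + z3 * y ^ 2) ≤ HH g x - (z1 + z2 * x + z3 * x ^ 2)) :
    ∃ u, x < u ∧ u < y ∧ PP g u - (z2 + (2 * z3) * u) ≤ 0 := by
  obtain ⟨u, h1, h2, h3⟩ := hg.mvt z1 z2 z3 hxy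
  refine ⟨u, h1, h2, ?_⟩
  by_contra! hc
  have := mul_pos hc (sub_pos.2 hxy)
  linarith

/-- dual feasibility in the two point case -/
lemma BM.dual_two {g M} (hg : BM g M) (hs : SQ g) {z1 z2 z3 x₁ x₂ : ℝ} (h0 : 0 ≤ x₁)
    (h12 : x₁ < x₂)
    (e1 : HH g x₁ = z1 + z2 * x₁ + z3 * x₁ ^ 2) (e2 : HH g x₂ = z1 + z2 * x₂ + z3 * x₂ ^ 2)
    (d2 : PP g x₂ = z2 + (2 * z3) * x₂) (d1 : PP g x₁ ≤ z2 + (2 * z3) * x₁)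
    (d1' : 0 < x₁ → PP g x₁ = z2 + (2 * z3) * x₁) {w : ℝ} (hw : 0 ≤ w) :
    HH g w ≤ z1 + z2 * w + z3 * w ^ 2 := by
  by_contra! hc
  rcases lt_trichotomy w x₁ with h | h | h
  · obtain ⟨u, hu1, hu2, hu⟩ := hg.mvt_neg z1 z2 z3 h (by linarith)
    obtain ⟨ξ, hξ1, hξ2, hξ⟩ := hg.mvt_neg z1 z2 z3 h12 (by linarith)
    have := d1' (by linarith)
    exact hg.noPattern hs z2 (2 * z3) (by linarith) hu2 hξ1 hξ2 hu (by linarith) hξ (by linarith)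
  · subst h; linarith
  · rcases lt_trichotomy w x₂ with h' | h' | h'
    · obtain ⟨u, hu1, hu2, hu⟩ := hg.mvt_pos z1 z2 z3 h (by linarith)
      obtain ⟨ξ, hξ1, hξ2, hξ⟩ := hg.mvt_neg z1 z2 z3 h' (by linarith)
      exact hg.noPattern hs z2 (2 * z3) h0 hu1 (hu2.trans hξ1) hξ2 (by linarith) hu hξ (by linarith)
    · subst h'; linarith
    · obtain ⟨u, hu1, hu2, hu⟩ := hg.mvt_pos z1 z2 z3 h' (by linarith)
      obtain ⟨ξ, hξ1, hξ2, hξ⟩ := hg.mvt_pos z1 z2 z3 h12 (by linarith)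
      exact hg.noPattern hs z2 (2 * z3) h0 hξ1 hξ2 hu1 (by linarith) hξ (by linarith) hu

/-- if `g ≤ b` on `(v, ∞)` then `2 λ ≤ b`. -/
lemma BM.lam_le {g M} (hg : BM g M) {lam b v : ℝ} 
    (hlam : Tendsto (fun x => HH g x / x ^ 2) atTop (𝓝 lam)) (hb : ∀ w, v < w → g w ≤ b) :
    2 * lam ≤ b := by
  have hP : ∀ x, v ≤ x → PP g x ≤ PP g v + b * (x - v) := by
    intro x hx
    have h1 : PP g x - PP g v ≤ b * (x - v) := by
      rw [hg.PP_sub]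
      have := intervalIntegral.integral_mono_on_of_le_Ioo hx (hg.ii v x) (intervalIntegrable_const (c := b))
        (fun t ht => hb t ht.1)
      simpa [mul_comm] using this
    linarith
  set C1 := HH g v - (PP g v * v) + b / 2 * v ^ 2 with hC1
  set C2 := PP g v - b * v with hC2
  have hH : ∀ x, v ≤ x → HH g x ≤ C1 + C2 * x + b / 2 * x ^ 2 := by
    intro x hx
    rcases hx.eq_or_lt with rfl | hx
    · rw [hC1, hC2]; linarith
    by_contra! hc
    obtain ⟨u, h1, h2, h3⟩ := hg.mvt C1 C2 (b / 2) hx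
    have : PP g u - (C2 + 2 * (b / 2) * u) ≤ 0 := by
      have := hP u h1.le
      rw [hC2]; linarith
    have := mul_nonpos_of_nonpos_of_nonneg this (sub_pos.2 hx).le
    rw [← h3] at this
    have : HH g v = C1 + C2 * v + b / 2 * v ^ 2 := by rw [hC1, hC2]; ring
    linarith
  have hlim : Tendsto (fun x : ℝ => C1 * (x⁻¹) ^ 2 + C2 * x⁻¹ + b / 2) atTop
      (𝓝 (C1 * 0 ^ 2 + C2 * 0 + b / 2)) :=
    (((tendsto_inv_atTop_zero.pow 2).const_mul C1).add (tendsto_inv_atTop_zero.const_mul C2)).add_const _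
  have := le_of_tendsto_of_tendsto hlam hlim (by
    filter_upwards [eventually_ge_atTop v, eventually_gt_atTop 0] with x hx hx0
    rw [div_le_iff₀ (by positivity)]
    have := hH x hx
    have e : (C1 * x⁻¹ ^ 2 + C2 * x⁻¹ + b / 2) * x ^ 2 = C1 + C2 * x + b / 2 * x ^ 2 := by
      field_simp
    linarith)
  linarith

/-- pattern at infinity -/
lemma BM.pattern_inf {g M} (hg : BM g M) (hs : SQ g) {lam : ℝ}
    (hlam : Tendsto (fun x => HH g x / x ^ 2) atTop (𝓝 lam)) (α : ℝ) {x y : ℝ} (hx : 0 ≤ x)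
    (hxy : x < y) (h1 : PP g x - (α + (2 * lam) * x) ≤ 0) (h2 : 0 ≤ PP g y - (α + (2 * lam) * y)) :
    ∃ δ > 0, ∃ N, ∀ w, N ≤ w → δ ≤ PP g w - (α + (2 * lam) * w) := by
  obtain ⟨u, hu1, hu2, hu⟩ := hg.exists_ge (κ := 2 * lam) hxy (by linarith)
  have hge : ∀ v, u < v → 2 * lam ≤ g v := by
    intro v hv
    by_contra! hc
    have : 2 * lam ≤ g v := by
      refine hg.lam_le (v := v) hlam fun w hw => ?_
      have := hs u v w (by linarith) hv hw
      rcases min_lt_iff.1 this with h | h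
      · linarith
      · exact h.le
    linarith
  have hgt : ∀ v, u < v → 2 * lam < g v := by
    intro v hv
    exact lt_of_le_of_lt (le_min hu (hge (v + 1) (by linarith)))
      (hs u v (v + 1) (by linarith) hv (by linarith))
  have hstr : ∀ p q, u ≤ p → p < q → PP g p - (α + (2 * lam) * p) < PP g q - (α + (2 * lam) * q) := by
    intro p q hp hpq
    by_contra! hc
    obtain ⟨v, hv1, hv2, hv⟩ := hg.exists_le (κ := 2 * lam) hpq (by linarith)
    have := hgt v (by linarith)
    linarith
  refine ⟨_, lt_of_le_of_lt h2 (hstr y (y + 1) hu2.le (by linarith)), y + 1, fun w hw => ?_⟩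
  rcases hw.eq_or_lt with rfl | hw
  · exact le_rfl
  · exact (hstr _ _ (by linarith) hw).le

lemma BM.D_unbdd {g M} (hg : BM g M) (hs : SQ g) {lam : ℝ}
    (hlam : Tendsto (fun x => HH g x / x ^ 2) atTop (𝓝 lam)) (z1 z2 : ℝ) {x y : ℝ} (hx : 0 ≤ x)
    (hxy : x < y) (h1 : PP g x - (z2 + (2 * lam) * x) ≤ 0) (h2 : 0 ≤ PP g y - (z2 + (2 * lam) * y)) :
    Tendsto (fun w => HH g w - (z1 + z2 * w + lam * w ^ 2)) atTop atTop := by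
  obtain ⟨δ, hδ, N, hN⟩ := hg.pattern_inf hs hlam z2 hx hxy h1 h2
  have hl : Tendsto (fun w => (HH g N - (z1 + z2 * N + lam * N ^ 2)) + δ * (w - N)) atTop atTop := by
    refine tendsto_atTop_add_const_left _ _ ?_
    refine Tendsto.const_mul_atTop hδ ?_
    exact tendsto_atTop_add_const_right _ (-N) tendsto_id
  refine tendsto_atTop_mono' _ ?_ hl
  filter_upwards [eventually_gt_atTop N] with w hw
  obtain ⟨u, hu1, hu2, hu⟩ := hg.mvt z1 z2 lam hw
  have := hN u hu1.le
  have := mul_le_mul_of_nonneg_right this (sub_pos.2 hw).le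
  linarith


noncomputable def x2 (μ σ t : ℝ) : ℝ := (σ - μ * t) / (μ - t)

/-- normalised objective -/
noncomputable def ww (μ σ lam : ℝ) (g : ℝ → ℝ) (t : ℝ) : ℝ :=
  if t = μ then HH g μ + lam * (σ - μ ^ 2)
  else (σ - μ ^ 2) / (σ - 2 * μ * t + t ^ 2) * HH g t +
    (μ - t) ^ 2 / (σ - 2 * μ * t + t ^ 2) * HH g (x2 μ σ t)

lemma Wfun_eq (a ν μ σ lam : ℝ) (h : ℝ → ℝ) (t : ℝ) :
    Wfun a ν μ σ lam h t = ν * ww μ σ lam (fun v => h (v + a)) t := by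
  unfold Wfun ww x2
  split_ifs <;> simp only [Hfun_eq]

lemma den_pos {μ σ : ℝ} (hs : μ ^ 2 < σ) (t : ℝ) : 0 < σ - 2 * μ * t + t ^ 2 := by
  nlinarith [sq_nonneg (μ - t)]

lemma x2_gt {μ σ t : ℝ} (hs : μ ^ 2 < σ) (ht : t < μ) : μ < x2 μ σ t := by
  unfold x2
  rw [lt_div_iff₀ (by linarith)]
  nlinarith

lemma x2_mul {μ σ t : ℝ} (ht : t < μ) : (μ - t) * x2 μ σ t = σ - μ * t := by
  unfold x2
  have : μ - t ≠ 0 := by linarith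
  field_simp

/-- two-point moment identity -/
lemma two_point {μ σ t : ℝ} (hs : μ ^ 2 < σ) (ht : t < μ) (z1 z2 z3 : ℝ) :
    (σ - μ ^ 2) / (σ - 2 * μ * t + t ^ 2) * (z1 + z2 * t + z3 * t ^ 2) +
    (μ - t) ^ 2 / (σ - 2 * μ * t + t ^ 2) * (z1 + z2 * x2 μ σ t + z3 * (x2 μ σ t) ^ 2)
     = z1 + z2 * μ + z3 * σ := by
  have hd := (den_pos hs t).ne'
  have e := x2_mul (σ := σ) ht
  set X := x2 μ σ t
  rw [div_mul_eq_mul_div, div_mul_eq_mul_div, ← add_div, div_eq_iff hd]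
  have e2 : (μ - t) ^ 2 * (z1 + z2 * X + z3 * X ^ 2) =
    z1 * (μ - t) ^ 2 + z2 * (μ - t) * ((μ - t) * X) + z3 * ((μ - t) * X) ^ 2 := by ring
  rw [e2, e]
  ring

lemma x2_tendsto {μ σ : ℝ} (hs : μ ^ 2 < σ) : Tendsto (x2 μ σ) (𝓝[<] μ) atTop := by
  have h1 : Tendsto (fun t => σ - μ * t) (𝓝[<] μ) (𝓝 (σ - μ * μ)) :=
    ((continuous_const.sub (continuous_const.mul continuous_id)).tendsto μ).mono_left
      nhdsWithin_le_nhds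
  have h2 : Tendsto (fun t => μ - t) (𝓝[<] μ) (𝓝[>] 0) := by
    refine tendsto_nhdsWithin_iff.2 ⟨?_, ?_⟩
    · have : Tendsto (fun t => μ - t) (𝓝 μ) (𝓝 (μ - μ)) :=
        (continuous_const.sub continuous_id).tendsto μ
      rw [sub_self] at this
      exact this.mono_left nhdsWithin_le_nhds
    · filter_upwards [self_mem_nhdsWithin] with t ht
      have ht' : t < μ := ht
      exact sub_pos.2 ht'
  exact h1.pos_mul_atTop (by nlinarith) (tendsto_inv_nhdsGT_zero.comp h2)

lemma ww_tendsto {μ σ lam M : ℝ} {g : ℝ → ℝ} (hg : BM g M) (hs : μ ^ 2 < σ)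
    (hlam : Tendsto (fun x => HH g x / x ^ 2) atTop (𝓝 lam)) :
    Tendsto (ww μ σ lam g) (𝓝[<] μ) (𝓝 (ww μ σ lam g μ)) := by
  have hc : ∀ F : ℝ → ℝ, Continuous F → Tendsto F (𝓝[<] μ) (𝓝 (F μ)) := fun F hF =>
    (hF.tendsto μ).mono_left nhdsWithin_le_nhds
  have h1 := hc (fun t => (σ - μ ^ 2) / (σ - 2 * μ * t + t ^ 2) * HH g t) (by
    refine Continuous.mul (Continuous.div continuous_const (by fun_prop) fun t => (den_pos hs t).ne')
      hg.HH_cont)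
  have h2 := hc (fun t => (σ - μ * t) ^ 2 / (σ - 2 * μ * t + t ^ 2)) (by
    refine Continuous.div (by fun_prop) (by fun_prop) fun t => (den_pos hs t).ne')
  have h3 := hlam.comp (x2_tendsto (μ := μ) hs)
  have h4 := h1.add (h2.mul h3)
  have e : ww μ σ lam g μ = (σ - μ ^ 2) / (σ - 2 * μ * μ + μ ^ 2) * HH g μ +
     (σ - μ * μ) ^ 2 / (σ - 2 * μ * μ + μ ^ 2) * lam := by
    rw [ww, if_pos rfl]
    have e1 : σ - 2 * μ * μ + μ ^ 2 = σ - μ ^ 2 := by ring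
    have e2 : σ - μ * μ = σ - μ ^ 2 := by ring
    have : σ - μ ^ 2 ≠ 0 := by linarith
    rw [e1, e2]
    field_simp
  rw [e]
  refine h4.congr' ?_
  filter_upwards [self_mem_nhdsWithin, (x2_tendsto (μ := μ) hs).eventually_gt_atTop 0] with t ht hx
  have ht : t < μ := ht
  rw [ww, if_neg ht.ne]
  simp only [Function.comp]
  rw [← x2_mul ht]
  field_simp

lemma x2_hasDeriv {μ σ t : ℝ} (ht : t < μ) : ∃ d, HasDerivAt (x2 μ σ) d t := by
  have h1 : HasDerivAt (fun t => σ - μ * t) (-(μ * 1)) t := ((hasDerivAt_id t).const_mul μ).const_sub σ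
  have h2 : HasDerivAt (fun t => μ - t) (-1) t := (hasDerivAt_id t).const_sub μ
  exact ⟨_, h1.div h2 (by linarith)⟩

lemma ww_contOn {μ σ lam M : ℝ} {g : ℝ → ℝ} (hg : BM g M) (hs : μ ^ 2 < σ)
    (hlam : Tendsto (fun x => HH g x / x ^ 2) atTop (𝓝 lam)) :
    ContinuousOn (ww μ σ lam g) (Icc 0 μ) := by
  intro t ht
  rcases ht.2.eq_or_lt with rfl | htm
  · have : ContinuousWithinAt (ww t σ lam g) (Iio t) t := ww_tendsto hg hs hlam
    have := continuousWithinAt_insert_self.2 this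
    exact this.mono fun y hy => by
      rcases hy.2.eq_or_lt with h | h
      · exact Or.inl h
      · exact Or.inr h
  · refine ContinuousAt.continuousWithinAt ?_
    obtain ⟨d, hd⟩ := x2_hasDeriv (σ := σ) htm
    have : ContinuousAt (fun t => (σ - μ ^ 2) / (σ - 2 * μ * t + t ^ 2) * HH g t +
      (μ - t) ^ 2 / (σ - 2 * μ * t + t ^ 2) * HH g (x2 μ σ t)) t := by
      have c1 : ContinuousAt (HH g) (x2 μ σ t) := hg.HH_cont.continuousAt
      have c2 : ContinuousAt (fun t => HH g (x2 μ σ t)) t :=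
        ContinuousAt.comp (f := x2 μ σ) c1 hd.continuousAt
      have c3 : ContinuousAt (fun t => σ - 2 * μ * t + t ^ 2) t := by fun_prop
      exact ((continuousAt_const.div c3 (den_pos hs t).ne').mul hg.HH_cont.continuousAt).add
        (((by fun_prop : ContinuousAt (fun t => (μ - t) ^ 2) t).div c3 (den_pos hs t).ne').mul c2)
    refine this.congr ?_
    filter_upwards [eventually_lt_nhds htm] with y hy
    rw [ww, if_neg hy.ne]

lemma dual_exists {μ σ lam M : ℝ} {g : ℝ → ℝ} (hg : BM g M) (hsq : SQ g) (hμ : 0 < μ)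
    (hs : μ ^ 2 < σ) (hlam : Tendsto (fun x => HH g x / x ^ 2) atTop (𝓝 lam)) :
    ∃ t ∈ Icc 0 μ, ∃ z1 z2 z3 : ℝ, (∀ x, 0 ≤ x → HH g x ≤ z1 + z2 * x + z3 * x ^ 2) ∧
      z1 + z2 * μ + z3 * σ = ww μ σ lam g t := by
  obtain ⟨t, ht, hmax⟩ := isCompact_Icc.exists_isMaxOn (nonempty_Icc.2 hμ.le)
    (ww_contOn hg hs hlam)
  refine ⟨t, ht, ?_⟩
  have key : ∀ z1 z2 z3 : ℝ, z1 + z2 * μ + z3 * σ = ww μ σ lam g t → ∀ y ∈ Icc 0 μ, y < μ →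
      (σ - μ ^ 2) * (HH g y - (z1 + z2 * y + z3 * y ^ 2)) +
      (μ - y) ^ 2 * (HH g (x2 μ σ y) - (z1 + z2 * x2 μ σ y + z3 * (x2 μ σ y) ^ 2)) ≤ 0 := by
    intro z1 z2 z3 hz y hy hym
    have h1 : ww μ σ lam g y ≤ ww μ σ lam g t := hmax hy
    rw [← hz, ← two_point hs hym z1 z2 z3, ww, if_neg hym.ne] at h1
    have hd := den_pos hs y
    have h2 := mul_le_mul_of_nonneg_right h1 hd.le
    rw [div_mul_eq_mul_div, div_mul_eq_mul_div, ← add_div, div_mul_cancel₀ _ hd.ne',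
      div_mul_eq_mul_div, div_mul_eq_mul_div, ← add_div, div_mul_cancel₀ _ hd.ne'] at h2
    linarith
  rcases ht.2.eq_or_lt with rfl | htm
  · skip
    obtain ⟨z1, hz1⟩ : ∃ z1, z1 = HH g t - PP g t * t + lam * t ^ 2 := ⟨_, rfl⟩
    obtain ⟨z2, hz2⟩ : ∃ z2, z2 = PP g t - 2 * lam * t := ⟨_, rfl⟩
    have hval : z1 + z2 * t + lam * σ = ww t σ lam g t := by
      rw [ww, if_pos rfl, hz1, hz2]; ring
    have hD : HH g t - (z1 + z2 * t + lam * t ^ 2) = 0 := by rw [hz1, hz2]; ring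
    have hφ : PP g t - (z2 + 2 * lam * t) = 0 := by rw [hz2]; ring
    refine ⟨z1, z2, lam, ?_, hval⟩
    have hnot : ¬ Tendsto (fun w => HH g w - (z1 + z2 * w + lam * w ^ 2)) atTop atTop := by
      intro hT
      have hT2 := hT.comp (x2_tendsto (μ := t) hs)
      set L := |M| + 2 * |lam| with hL
      have hlow : ∀ y, y < t → -(L * (t - y) ^ 2) ≤ HH g y - (z1 + z2 * y + lam * y ^ 2) := by
        intro y hy
        obtain ⟨u, hu1, hu2, hu⟩ := hg.mvt z1 z2 lam hy
        have a1 := hg.PP_mono hu2.le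
        have a2 := hg.PP_lip hu2.le
        have a3 : PP g u - (z2 + 2 * lam * u) ≤ L * (t - y) := by
          have : 2 * lam * (t - u) ≤ 2 * |lam| * (t - y) := by
            have := le_abs_self lam
            have := abs_nonneg lam
            nlinarith
          have : 0 ≤ |M| * (t - y) := mul_nonneg (abs_nonneg _) (by linarith)
          rw [hL]
          linarith
        have := mul_le_mul_of_nonneg_right a3 (sub_pos.2 hy).le
        rw [← hu] at this
        linarith
      have hev := hT2.eventually_gt_atTop ((σ - t ^ 2) * L)
      have hmem : ∀ᶠ y in 𝓝[<] t, 0 < y := by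
        exact (eventually_gt_nhds hμ).filter_mono nhdsWithin_le_nhds
      obtain ⟨y, h1, h2, h3⟩ := (hev.and (hmem.and self_mem_nhdsWithin)).exists
      have h3 : y < t := h3
      have h4 := key z1 z2 lam hval y ⟨h2.le, h3.le⟩ h3
      have h5 := hlow y h3
      simp only [Function.comp] at h1
      have h6 : 0 < (t - y) ^ 2 := by have := sub_pos.2 h3; positivity
      have h7 := mul_le_mul_of_nonneg_left h5 (sub_pos.2 hs).le
      have h8 := mul_lt_mul_of_pos_left h1 h6
      nlinarith
    intro w hw
    by_contra! hc
    rcases lt_trichotomy w t with h | h | h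
    · obtain ⟨u, hu1, hu2, hu⟩ := hg.mvt_neg z1 z2 lam h (by linarith)
      exact hnot (hg.D_unbdd hsq hlam z1 z2 (by linarith) hu2 hu hφ.ge)
    · subst h; linarith
    · obtain ⟨u, hu1, hu2, hu⟩ := hg.mvt_pos z1 z2 lam h (by linarith)
      exact hnot (hg.D_unbdd hsq hlam z1 z2 hμ.le hu1 hφ.le hu)
  · skip
    have hX := x2_gt hs htm
    obtain ⟨X, hXd⟩ : ∃ X, X = x2 μ σ t := ⟨_, rfl⟩
    rw [← hXd] at hX
    have htX : t < X := htm.trans hX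
    obtain ⟨z3, hz3⟩ : ∃ z3, z3 = (HH g t - HH g X - PP g X * (t - X)) / (t - X) ^ 2 := ⟨_, rfl⟩
    obtain ⟨z2, hz2⟩ : ∃ z2, z2 = PP g X - 2 * z3 * X := ⟨_, rfl⟩
    obtain ⟨z1, hz1⟩ : ∃ z1, z1 = HH g X - PP g X * X + z3 * X ^ 2 := ⟨_, rfl⟩
    have e1 : HH g t = z1 + z2 * t + z3 * t ^ 2 := by
      have : z3 * (t - X) ^ 2 = HH g t - HH g X - PP g X * (t - X) := by
        rw [hz3, div_mul_cancel₀]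
        have := (sub_neg.2 htX).ne
        positivity
      rw [hz1, hz2]
      linarith
    have e2 : HH g X = z1 + z2 * X + z3 * X ^ 2 := by rw [hz1, hz2]; ring
    have d2 : PP g X = z2 + 2 * z3 * X := by rw [hz2]; ring
    have hval : z1 + z2 * μ + z3 * σ = ww μ σ lam g t := by
      rw [ww, if_neg htm.ne, ← two_point hs htm z1 z2 z3, ← hXd, e1, e2]
    set Ψ : ℝ → ℝ := fun y => (σ - μ ^ 2) * (HH g y - (z1 + z2 * y + z3 * y ^ 2)) +
      (μ - y) ^ 2 * (HH g (x2 μ σ y) - (z1 + z2 * x2 μ σ y + z3 * (x2 μ σ y) ^ 2)) with hΨ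
    have hDd : ∀ u, HasDerivAt (fun x => HH g x - (z1 + z2 * x + z3 * x ^ 2))
        (PP g u - (z2 + (2 * z3) * u)) u := fun u => hg.D_deriv z1 z2 z3 u
    have hΨd : HasDerivAt Ψ ((σ - μ ^ 2) * (PP g t - (z2 + (2 * z3) * t))) t := by
      obtain ⟨d, hd⟩ := x2_hasDeriv (σ := σ) htm
      have k1 := (hDd t).const_mul (σ - μ ^ 2)
      have k2 : HasDerivAt (fun y => HH g (x2 μ σ y) - (z1 + z2 * x2 μ σ y + z3 * (x2 μ σ y) ^ 2))
        (0 * d) t := by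
        have := hDd (x2 μ σ t)
        rw [← hXd, d2, sub_self, hXd] at this
        exact HasDerivAt.comp t this hd
      have k3 : HasDerivAt (fun y : ℝ => (μ - y) ^ 2) _ t := ((hasDerivAt_id t).const_sub μ).pow 2
      refine (k1.add (k3.mul k2)).congr_deriv ?_
      rw [← hXd, e2]
      ring
    have hΨt : Ψ t = 0 := by
      simp only [hΨ]; rw [← hXd, ← e1, ← e2]; ring
    have hsp : 0 < σ - μ ^ 2 := sub_pos.2 hs
    have hle : ∀ y ∈ Icc 0 μ, y < μ → Ψ y ≤ Ψ t := fun y hy hym => by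
      rw [hΨt]; exact key z1 z2 z3 hval y hy hym
    refine ⟨z1, z2, z3, fun x hx => hg.dual_two hsq ht.1 htX e1 e2 d2 ?_ ?_ hx, hval⟩
    · by_contra! hc
      have hpos : 0 < (σ - μ ^ 2) * (PP g t - (z2 + (2 * z3) * t)) := mul_pos hsp (by linarith)
      have := hΨd.hasDerivWithinAt (s := Ioi t)
      rw [hasDerivWithinAt_iff_tendsto_slope' self_notMem_Ioi] at this
      have hev := this.eventually (eventually_gt_nhds hpos)
      have hev2 : ∀ᶠ y in 𝓝[>] t, y < μ := (eventually_lt_nhds htm).filter_mono nhdsWithin_le_nhds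
      obtain ⟨y, h1, h2, h3⟩ := (hev.and (hev2.and self_mem_nhdsWithin)).exists
      have h3 : t < y := h3
      have h4 := hle y ⟨by linarith [ht.1], h2.le⟩ h2
      rw [slope_def_field] at h1
      have := div_nonpos_of_nonpos_of_nonneg (sub_nonpos.2 h4) (sub_pos.2 h3).le
      linarith
    · intro ht0
      have hloc : IsLocalMax Ψ t := by
        filter_upwards [eventually_lt_nhds htm, eventually_gt_nhds ht0] with y h1 h2
        exact hle y ⟨h2.le, h1.le⟩ h1
      have := hloc.hasDerivAt_eq_zero hΨd
      rcases mul_eq_zero.1 this with h | h <;> linarith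


lemma PP_zero (g : ℝ → ℝ) : PP g 0 = 0 := by simp [PP]

lemma BM.HH_nonneg {g M} (hg : BM g M) {x : ℝ} (hx : 0 ≤ x) : 0 ≤ HH g x := by
  refine intervalIntegral.integral_nonneg hx fun u hu => ?_
  have := hg.PP_mono hu.1
  rw [PP_zero] at this; linarith

lemma BM.HH_le {g M} (hg : BM g M) {x : ℝ} (hx : 0 ≤ x) : HH g x ≤ M / 2 * x ^ 2 := by
  rcases hx.eq_or_lt with rfl | hx
  · simp [HH_zero]
  obtain ⟨u, h1, h2, h3⟩ := hg.mvt 0 0 (M / 2) hx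
  have := hg.PP_lip h1.le
  rw [PP_zero] at this
  have h4 : (PP g u - (0 + 2 * (M / 2) * u)) * (x - 0) ≤ 0 :=
    mul_nonpos_of_nonpos_of_nonneg (by linarith) (by linarith)
  rw [← h3, HH_zero] at h4
  linarith

lemma PP_congr {g₁ g₂ : ℝ → ℝ} (h : ∀ᵐ v, 0 < v → g₁ v = g₂ v) {x : ℝ} (hx : 0 ≤ x) :
    PP g₁ x = PP g₂ x := by
  refine intervalIntegral.integral_congr_ae ?_
  filter_upwards [h] with v hv hm
  rw [uIoc_of_le hx] at hm
  exact hv hm.1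

lemma HH_congr {g₁ g₂ : ℝ → ℝ} (h : ∀ᵐ v, 0 < v → g₁ v = g₂ v) {x : ℝ} (hx : 0 ≤ x) :
    HH g₁ x = HH g₂ x := by
  refine intervalIntegral.integral_congr fun v hv => ?_
  rw [uIcc_of_le hx] at hv
  exact PP_congr h hv.1

lemma HH_add_mul {g k : ℝ → ℝ} {M N : ℝ} (hg : BM g M) (hk : BM k N) (ε x : ℝ) :
    HH (fun v => g v + ε * k v) x = HH g x + ε * HH k x := by
  have h1 : ∀ u, PP (fun v => g v + ε * k v) u = PP g u + ε * PP k u := by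
    intro u
    unfold PP
    rw [intervalIntegral.integral_add (hg.ii _ _) ((hk.ii _ _).const_mul ε),
      intervalIntegral.integral_const_mul]
  unfold HH
  simp_rw [h1]
  rw [intervalIntegral.integral_add (hg.PP_cont.intervalIntegrable _ _)
    ((hk.PP_cont.intervalIntegrable _ _).const_mul ε),
      intervalIntegral.integral_const_mul]

noncomputable def jj (b : ℝ) (v : ℝ) : ℝ := 1 / (1 + (v - b) ^ 2)

lemma jj_BM (b : ℝ) : BM (jj b) 1 where
  meas := by unfold jj; fun_prop
  nn x := by unfold jj; positivity
  le x := by unfold jj; rw [div_le_one (by positivity)]; nlinarith [sq_nonneg (x - b)]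

lemma jj_PP (b x : ℝ) : PP (jj b) x = Real.arctan (x - b) - Real.arctan (0 - b) := by
  unfold PP jj
  rw [intervalIntegral.integral_comp_sub_right (fun v => 1 / (1 + v ^ 2)) b]
  exact integral_one_div_one_add_sq

lemma jj_lim (b : ℝ) : Tendsto (fun x => HH (jj b) x / x ^ 2) atTop (𝓝 0) := by
  have hlim : Tendsto (fun x : ℝ => Real.pi * x⁻¹) atTop (𝓝 (Real.pi * 0)) :=
    tendsto_inv_atTop_zero.const_mul _
  rw [mul_zero] at hlim
  refine tendsto_of_tendsto_of_tendsto_of_le_of_le' tendsto_const_nhds hlim ?_ ?_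
  · filter_upwards [eventually_gt_atTop 0] with x hx
    have := (jj_BM b).HH_nonneg hx.le
    positivity
  · filter_upwards [eventually_gt_atTop 0] with x hx
    obtain ⟨u, h1, h2, h3⟩ := (jj_BM b).mvt 0 0 0 hx
    rw [jj_PP, HH_zero] at h3
    have a1 := Real.arctan_lt_pi_div_two (u - b)
    have a2 := Real.neg_pi_div_two_lt_arctan (0 - b)
    have : HH (jj b) x ≤ Real.pi * x := by
      have : HH (jj b) x = (Real.arctan (u - b) - Real.arctan (0 - b)) * x := by linarith
      rw [this]
      exact mul_le_mul_of_nonneg_right (by linarith) hx.le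
    rw [div_le_iff₀ (by positivity)]
    have e : Real.pi * x⁻¹ * x ^ 2 = Real.pi * x := by field_simp
    rwa [e]

lemma const_BM : BM (fun _ => (1:ℝ)) 1 := ⟨measurable_const, fun _ => zero_le_one, fun _ => le_rfl⟩

lemma const_HH (x : ℝ) : HH (fun _ => (1:ℝ)) x = x ^ 2 / 2 := by
  simp [HH, PP]

lemma exists_k (a : ℝ) (c : EReal) (hc : c ≠ ⊥) : ∃ (k : ℝ → ℝ) (lk : ℝ), BM k 1 ∧ lk ≤ 1 / 2 ∧
    Tendsto (fun x => HH k x / x ^ 2) atTop (𝓝 lk) ∧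
    (∀ u v : ℝ, 0 < u → u < v → ((v + a : ℝ) : EReal) < c → k u < k v) ∧
    (∀ u v : ℝ, u < v → c < ((u + a : ℝ) : EReal) → k v < k u) := by
  induction c with
  | bot => exact absurd rfl hc
  | coe c =>
    refine ⟨jj (c - a), 0, jj_BM _, by norm_num, jj_lim _, ?_, ?_⟩
    · intro u v _ huv hv
      rw [EReal.coe_lt_coe_iff] at hv
      unfold jj
      refine one_div_lt_one_div_of_lt (by positivity) ?_
      nlinarith
    · intro u v huv hv
      rw [EReal.coe_lt_coe_iff] at hv
      unfold jj
      refine one_div_lt_one_div_of_lt (by positivity) ?_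
      nlinarith
  | top =>
    have hb : BM (fun v => 1 + (-1) * jj 0 v) 1 := by
      refine ⟨measurable_const.add ((jj_BM 0).meas.const_mul _), fun x => ?_, fun x => ?_⟩
      · have := (jj_BM 0).le x; linarith
      · have := (jj_BM 0).nn x; linarith
    refine ⟨fun v => 1 + (-1) * jj 0 v, 1 / 2, hb, le_rfl, ?_, ?_, ?_⟩
    · have h1 : Tendsto (fun x => 1 / 2 - HH (jj 0) x / x ^ 2) atTop (𝓝 (1 / 2 - 0)) :=
        (jj_lim 0).const_sub (1 / 2)
      rw [sub_zero] at h1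
      refine h1.congr' ?_
      filter_upwards [eventually_gt_atTop 0] with x hx
      rw [HH_add_mul const_BM (jj_BM 0), const_HH]
      field_simp
      ring
    · intro u v hu huv _
      have : jj 0 v < jj 0 u := by
        unfold jj
        refine one_div_lt_one_div_of_lt (by positivity) ?_
        nlinarith
      simp only
      linarith
    · intro u v huv hv
      exact absurd hv (not_lt.2 le_top)

/-- the positive part of the shifted function is measurable -/
lemma meas_pos (a M : ℝ) (h : ℝ → ℝ) (hbd : ∀ x, h x ≤ M) (hpos : ∀ x, 0 ≤ h x) (c : EReal)
    (h1 : MonotoneOn h {x : ℝ | a ≤ x ∧ (x : EReal) < c})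
    (h2 : AntitoneOn h {x : ℝ | c < (x : EReal)}) :
    Measurable (fun v : ℝ => if 0 < v then h (v + a) else 0) := by
  have hb : ∀ s : Set ℝ, BddBelow (h '' s) := fun s => ⟨0, by rintro _ ⟨x, _, rfl⟩; exact hpos x⟩
  have ha : ∀ s : Set ℝ, BddAbove (h '' s) := fun s => ⟨M, by rintro _ ⟨x, _, rfl⟩; exact hbd x⟩
  obtain ⟨G1, hG1, e1⟩ := h1.exists_monotone_extension (hb _) (ha _)
  obtain ⟨G2, hG2, e2⟩ := h2.exists_antitone_extension (hb _) (ha _)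
  have hm : Measurable (fun x : ℝ => if a < x then
      (if (x : EReal) < c then G1 x else if c < (x : EReal) then G2 x else h c.toReal) else 0) := by
    refine Measurable.ite (measurableSet_lt measurable_const measurable_id) ?_ measurable_const
    refine Measurable.ite (measurableSet_lt measurable_coe_real_ereal measurable_const) hG1.measurable ?_
    exact Measurable.ite (measurableSet_lt measurable_const measurable_coe_real_ereal) hG2.measurable
      measurable_const
  have hm2 := hm.comp (measurable_id.add_const a)
  convert hm2 using 1
  funext v
  simp only [Function.comp, id]
  by_cases hv : 0 < v
  · rw [if_pos hv, if_pos (by linarith : a < v + a)]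
    split_ifs with i1 i2
    · exact e1 ⟨by linarith, i1⟩
    · exact e2 i2
    · have : c = ((v + a : ℝ) : EReal) := le_antisymm (not_lt.1 i1) (not_lt.1 i2)
      rw [this, EReal.toReal_coe]
  · rw [if_neg hv, if_neg (by linarith : ¬ a < v + a)]

lemma dual_approx {a M : ℝ} {h : ℝ → ℝ} (hbd : ∀ x, h x ≤ M) (hpos : ∀ x, 0 ≤ h x) {c : EReal}
    (hc : c ≠ ⊥)
    (h1 : MonotoneOn h {x : ℝ | a ≤ x ∧ (x : EReal) < c})
    (h2 : AntitoneOn h {x : ℝ | c < (x : EReal)}) {μ σ lam : ℝ} (hμ : 0 < μ) (hs : μ ^ 2 < σ)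
    (hlam : Tendsto (fun x => HH (fun v => h (v + a)) x / x ^ 2) atTop (𝓝 lam)) {ε : ℝ} (hε : 0 < ε) :
    ∃ t ∈ Icc 0 μ, ∃ z1 z2 z3 : ℝ,
      (∀ x, 0 ≤ x → HH (fun v => h (v + a)) x ≤ z1 + z2 * x + z3 * x ^ 2) ∧
      z1 + z2 * μ + z3 * σ ≤ ww μ σ lam (fun v => h (v + a)) t + ε * (σ / 2) := by
  obtain ⟨k, lk, hk, hlk, hkl, hk1, hk2⟩ := exists_k a c hc
  set G : ℝ → ℝ := fun v => if 0 < v then h (v + a) else 0 with hG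
  have hM : 0 ≤ M := (hpos 0).trans (hbd 0)
  have hGB : BM G M := by
    refine ⟨meas_pos a M h hbd hpos c h1 h2, fun v => ?_, fun v => ?_⟩
    · simp only [hG]; split_ifs
      · exact hpos _
      · exact le_rfl
    · simp only [hG]; split_ifs
      · exact hbd _
      · exact hM
  have hGH : ∀ x, 0 ≤ x → HH G x = HH (fun v => h (v + a)) x := fun x hx =>
    HH_congr (Eventually.of_forall fun v hv => by simp only [hG, if_pos hv]) hx
  set ge : ℝ → ℝ := fun v => if ((v + a : ℝ) : EReal) = c then M + ε + 1 else G v + ε * k v with hge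
  have hgeB : BM ge (M + ε + 1) := by
    refine ⟨?_, fun v => ?_, fun v => ?_⟩
    · refine Measurable.ite ?_ measurable_const (hGB.meas.add (hk.meas.const_mul ε))
      exact measurableSet_eq_fun
        (measurable_coe_real_ereal.comp (measurable_id.add_const a)) measurable_const
    · simp only [hge]; split_ifs
      · positivity
      · have := hGB.nn v; have := hk.nn v; positivity
    · simp only [hge]; split_ifs
      · exact le_rfl
      · have := hGB.le v; have := hk.le v
        nlinarith
  have hae : ∀ᵐ v : ℝ, 0 < v → ge v = G v + ε * k v := by
    have hcount : ({v : ℝ | ((v + a : ℝ) : EReal) = c}).Subsingleton := by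
      intro u hu v hv
      have : ((u + a : ℝ) : EReal) = ((v + a : ℝ) : EReal) := hu.trans hv.symm
      rw [EReal.coe_eq_coe_iff] at this
      linarith
    have := hcount.countable.ae_notMem (volume : Measure ℝ)
    filter_upwards [this] with v hv _
    simp only [hge]
    exact if_neg hv
  have hgeH : ∀ x, 0 ≤ x → HH ge x = HH (fun v => h (v + a)) x + ε * HH k x := fun x hx => by
    rw [HH_congr hae hx, HH_add_mul hGB hk, hGH x hx]
  have hsq : SQ ge := by
    intro u v w hu huv hvw
    have cu : ((u + a : ℝ) : EReal) < ((v + a : ℝ) : EReal) := by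
      rw [EReal.coe_lt_coe_iff]; linarith
    have cw : ((v + a : ℝ) : EReal) < ((w + a : ℝ) : EReal) := by
      rw [EReal.coe_lt_coe_iff]; linarith
    rcases lt_trichotomy ((v + a : ℝ) : EReal) c with hv | hv | hv
    · refine lt_of_le_of_lt (min_le_left _ _) ?_
      simp only [hge, hG]
      rw [if_neg (cu.trans hv).ne, if_neg hv.ne, if_pos hu, if_pos (hu.trans huv)]
      have b1 := hk1 u v hu huv hv
      have b2 := h1 (a := u + a) (b := v + a) ⟨by linarith, cu.trans hv⟩ ⟨by linarith, hv⟩ (by linarith)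
      nlinarith
    · refine lt_of_le_of_lt (min_le_left _ _) ?_
      simp only [hge]
      rw [if_pos hv, if_neg (hv ▸ cu).ne]
      have := hGB.le u; have := hk.le u
      nlinarith
    · refine lt_of_le_of_lt (min_le_right _ _) ?_
      simp only [hge, hG]
      rw [if_neg (hv.trans cw).ne', if_neg hv.ne', if_pos (by linarith), if_pos (hu.trans huv)]
      have b1 := hk2 v w hvw hv
      have b2 := h2 (a := v + a) (b := w + a) hv (hv.trans cw) (by linarith)
      nlinarith
  have hgel : Tendsto (fun x => HH ge x / x ^ 2) atTop (𝓝 (lam + ε * lk)) := by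
    refine (hlam.add (hkl.const_mul ε)).congr' ?_
    filter_upwards [eventually_ge_atTop 0] with x hx
    rw [hgeH x hx]; ring
  obtain ⟨t, ht, z1, z2, z3, hz, hv⟩ := dual_exists hgeB hsq hμ hs hgel
  refine ⟨t, ht, z1, z2, z3, fun x hx => ?_, ?_⟩
  · have := hz x hx
    rw [hgeH x hx] at this
    have := mul_nonneg hε.le (hk.HH_nonneg hx)
    linarith
  · rw [hv]
    rcases ht.2.eq_or_lt with rfl | htm
    · simp only [ww, if_true]
      rw [hgeH _ ht.1]
      have e1 := mul_le_mul_of_nonneg_left (hk.HH_le ht.1) hε.le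
      have e2 := mul_le_mul_of_nonneg_left
        (mul_le_mul_of_nonneg_right hlk (sub_pos.2 hs).le) hε.le
      linarith
    · simp only [ww, if_neg htm.ne]
      have hX := (hμ.trans (x2_gt hs htm)).le
      rw [hgeH _ ht.1, hgeH _ hX]
      have hd := den_pos hs t
      have e0 := two_point hs htm 0 0 (1 / 2)
      have p1 : 0 ≤ (σ - μ ^ 2) / (σ - 2 * μ * t + t ^ 2) := div_nonneg (sub_pos.2 hs).le hd.le
      have p2 : 0 ≤ (μ - t) ^ 2 / (σ - 2 * μ * t + t ^ 2) := by positivity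
      have e1 := mul_le_mul_of_nonneg_left (hk.HH_le ht.1) p1
      have e2 := mul_le_mul_of_nonneg_left (hk.HH_le hX) p2
      generalize (σ - μ ^ 2) / (σ - 2 * μ * t + t ^ 2) = q1 at *
      generalize (μ - t) ^ 2 / (σ - 2 * μ * t + t ^ 2) = q2 at *
      have e3 : q1 * HH k t + q2 * HH k (x2 μ σ t) ≤ σ / 2 := by linarith
      have := mul_le_mul_of_nonneg_left e3 hε.le
      linarith

open scoped ENNReal

lemma tonelli (m : Measure ℝ) [IsFiniteMeasure m] (g : ℝ → ℝ≥0∞) (hg : Measurable g)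
    (hfin : ∀ x, g x ≠ ∞) :
    ∫⁻ x in Ioi (0:ℝ), g x * ∫⁻ t in Ioi x, m (Ioi t) =
    ∫⁻ y, (∫⁻ t in Ioo 0 y, ∫⁻ x in Ioo 0 t, g x) ∂m := by
  let F : ℝ → ℝ → ℝ → ℝ≥0∞ := fun x t y => {p : ℝ × ℝ × ℝ | 0 < p.1 ∧ p.1 < p.2.1 ∧ p.2.1 < p.2.2}.indicator
    (fun p => g p.1) (x, t, y)
  have hS : MeasurableSet {p : ℝ × ℝ × ℝ | 0 < p.1 ∧ p.1 < p.2.1 ∧ p.2.1 < p.2.2} := by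
    refine (measurableSet_lt measurable_const measurable_fst).inter
      ((measurableSet_lt measurable_fst (measurable_fst.comp measurable_snd)).inter
      (measurableSet_lt (measurable_fst.comp measurable_snd) (measurable_snd.comp measurable_snd)))
  have hF : Measurable (fun p : ℝ × ℝ × ℝ => F p.1 p.2.1 p.2.2) :=
    (hg.comp measurable_fst).indicator hS
  have l1 : ∫⁻ x in Ioi (0:ℝ), g x * ∫⁻ t in Ioi x, m (Ioi t) = ∫⁻ x, ∫⁻ t, ∫⁻ y, F x t y ∂m := by
    rw [← lintegral_indicator measurableSet_Ioi]
    refine lintegral_congr fun x => ?_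
    by_cases hx : 0 < x
    · rw [indicator_of_mem (show x ∈ Ioi (0:ℝ) from hx), ← lintegral_indicator measurableSet_Ioi,
        ← lintegral_const_mul' _ _ (hfin x)]
      refine lintegral_congr fun t => ?_
      by_cases ht : x < t
      · rw [indicator_of_mem (show t ∈ Ioi x from ht)]
        rw [← setLIntegral_const, ← lintegral_indicator measurableSet_Ioi]
        refine lintegral_congr fun y => ?_
        simp only [F, indicator, mem_ofPred_eq, mem_Ioi, hx, ht, true_and]
      · rw [indicator_of_notMem (show t ∉ Ioi x from ht)]
        simp [F, indicator, ht]
    · rw [indicator_of_notMem (show x ∉ Ioi (0:ℝ) from hx)]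
      simp [F, indicator, hx]
  have r1 : ∫⁻ y, (∫⁻ t in Ioo 0 y, ∫⁻ x in Ioo 0 t, g x) ∂m = ∫⁻ y, ∫⁻ t, ∫⁻ x, F x t y ∂volume ∂volume ∂m := by
    refine lintegral_congr fun y => ?_
    rw [← lintegral_indicator measurableSet_Ioo]
    refine lintegral_congr fun t => ?_
    by_cases ht : t ∈ Ioo 0 y
    · rw [indicator_of_mem ht, ← lintegral_indicator measurableSet_Ioo]
      refine lintegral_congr fun x => ?_
      simp only [F, indicator, mem_ofPred_eq, mem_Ioo, ht.2, and_true]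
    · rw [indicator_of_notMem ht]
      symm
      rw [lintegral_eq_zero_iff']
      · refine Eventually.of_forall fun x => ?_
        simp only [F, Pi.zero_apply]
        refine indicator_of_notMem ?_ _
        rintro ⟨a1, a2, a3⟩
        exact ht ⟨a1.trans a2, a3⟩
      · exact (hF.comp (measurable_id.prodMk (measurable_const (a := (t, y))))).aemeasurable
  rw [l1, r1]
  have s1 : ∫⁻ x, ∫⁻ t, ∫⁻ y, F x t y ∂m = ∫⁻ x, ∫⁻ y, ∫⁻ t, F x t y ∂volume ∂m := by
    refine lintegral_congr fun x => ?_
    refine lintegral_lintegral_swap ?_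
    exact (hF.comp (measurable_const.prodMk measurable_id)).aemeasurable
  have s2 : ∫⁻ x, ∫⁻ y, ∫⁻ t, F x t y ∂volume ∂m = ∫⁻ y, ∫⁻ x, ∫⁻ t, F x t y ∂volume ∂volume ∂m := by
    refine lintegral_lintegral_swap ?_
    have : Measurable (fun q : (ℝ × ℝ) × ℝ => F q.1.1 q.2 q.1.2) :=
      hF.comp ((measurable_fst.comp measurable_fst).prodMk
        (measurable_snd.prodMk (measurable_snd.comp measurable_fst)))
    exact this.lintegral_prod_right'.aemeasurable
  rw [s1, s2]
  refine lintegral_congr fun y => ?_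
  refine lintegral_lintegral_swap ?_
  exact (hF.comp (measurable_fst.prodMk (measurable_snd.prodMk measurable_const))).aemeasurable

lemma BM.lint_HH {g M} (hg : BM g M) {y : ℝ} (hy : 0 ≤ y) :
    (∫⁻ t in Ioo 0 y, ∫⁻ x in Ioo 0 t, ENNReal.ofReal (g x)) = ENNReal.ofReal (HH g y) := by
  have h1 : ∀ t, 0 ≤ t → ∫⁻ x in Ioo 0 t, ENNReal.ofReal (g x) = ENNReal.ofReal (PP g t) := by
    intro t ht
    unfold PP
    rw [intervalIntegral.integral_of_le ht, ← restrict_Ioo_eq_restrict_Ioc,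
      ofReal_integral_eq_lintegral_ofReal]
    · have := (hg.ii 0 t).1
      exact this.mono_set Ioo_subset_Ioc_self
    · exact Eventually.of_forall fun x => hg.nn x
  rw [setLIntegral_congr_fun measurableSet_Ioo (fun t ht => h1 t ht.1.le)]
  unfold HH
  rw [intervalIntegral.integral_of_le hy, ← restrict_Ioo_eq_restrict_Ioc,
      ofReal_integral_eq_lintegral_ofReal]
  · exact ((hg.PP_cont.intervalIntegrable 0 y).1).mono_set Ioo_subset_Ioc_self
  · filter_upwards [ae_restrict_mem measurableSet_Ioo] with t ht
    have := hg.PP_mono ht.1.le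
    rw [PP_zero] at this
    simpa using this

/-- `f` is represented by `m` -/
structure TRep (m : Measure ℝ) (f : ℝ → ℝ) : Prop where
  supp : m (Iio 0) = 0
  eq : ∀ x, 0 ≤ x → ENNReal.ofReal (f x) = ∫⁻ t in Ioi x, m (Ioi t)

lemma TRep.ae {m f} (h : TRep m f) : ∀ᵐ y ∂m, 0 ≤ y := by
  have : m {y | ¬ 0 ≤ y} = 0 := by
    convert h.supp using 2
    ext y; simp
  exact this

lemma TRep.lint {m f} [IsFiniteMeasure m] (h : TRep m f) {g M} (hg : BM g M) (hf : ∀ x, 0 ≤ x → 0 ≤ f x) :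
    ∫⁻ x in Ioi (0:ℝ), ENNReal.ofReal (g x * f x) = ∫⁻ y, ENNReal.ofReal (HH g y) ∂m := by
  have := tonelli m (fun x => ENNReal.ofReal (g x)) hg.meas.ennreal_ofReal
    (fun _ => ENNReal.ofReal_ne_top)
  rw [lintegral_congr_ae (h.ae.mono fun y hy => hg.lint_HH hy)] at this
  rw [← this]
  refine setLIntegral_congr_fun measurableSet_Ioi fun x hx => ?_
  have hx : 0 < x := hx
  rw [ENNReal.ofReal_mul (hg.nn x), h.eq x hx.le]

lemma TRep.lint_id {m f} [IsFiniteMeasure m] (h : TRep m f) :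
    ENNReal.ofReal (f 0) = ∫⁻ y, ENNReal.ofReal y ∂m := by
  rw [h.eq 0 le_rfl]
  exact (lintegral_eq_lintegral_meas_lt m h.ae aemeasurable_id).symm

lemma TRep.weak {m f} [IsFiniteMeasure m] (h : TRep m f) {g M} (hg : BM g M)
    (hf : ∀ x, 0 ≤ x → 0 ≤ f x) {β η ν : ℝ} (hν : 0 ≤ ν) (hm : m univ ≤ ENNReal.ofReal ν)
    (hint : IntegrableOn f (Ioi 0)) (hβ : ∫ x in Ioi (0:ℝ), f x = β) (hη : f 0 = η)
    {z1 z2 z3 : ℝ} (hz : ∀ x, 0 ≤ x → HH g x ≤ z1 + z2 * x + z3 * x ^ 2) :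
    ∫ x in Ioi (0:ℝ), g x * f x ≤ z1 * ν + z2 * η + 2 * z3 * β := by
  have hf' : ∀ᵐ x ∂(volume.restrict (Ioi (0:ℝ))), 0 ≤ f x := by
    filter_upwards [ae_restrict_mem measurableSet_Ioi] with x hx
    exact hf x (le_of_lt hx)
  have hη0 : 0 ≤ η := hη ▸ hf 0 le_rfl
  have hβ0 : 0 ≤ β := hβ ▸ integral_nonneg_of_ae hf'
  have i1 : ∫⁻ y, ENNReal.ofReal y ∂m = ENNReal.ofReal η := by rw [← h.lint_id, hη]
  have I1 : Integrable (fun y : ℝ => y) m := by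
    refine ⟨measurable_id.aestronglyMeasurable, ?_⟩
    rw [hasFiniteIntegral_iff_ofReal h.ae, i1]
    exact ENNReal.ofReal_lt_top
  have E1 : ∫ y, y ∂m = η := by
    rw [integral_eq_lintegral_of_nonneg_ae h.ae measurable_id.aestronglyMeasurable, i1,
      ENNReal.toReal_ofReal hη0]
  have i2 : ∫⁻ y, ENNReal.ofReal (y ^ 2 / 2) ∂m = ENNReal.ofReal β := by
    have := h.lint const_BM hf
    simp only [const_HH, one_mul] at this
    rw [← this, ← hβ, ofReal_integral_eq_lintegral_ofReal hint hf']
  have m2 : AEStronglyMeasurable (fun y : ℝ => y ^ 2 / 2) m :=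
    ((measurable_id.pow_const 2).div_const 2).aestronglyMeasurable
  have p2 : ∀ᵐ y ∂m, 0 ≤ y ^ 2 / 2 := Eventually.of_forall fun y => by positivity
  have I2 : Integrable (fun y : ℝ => y ^ 2 / 2) m := by
    refine ⟨m2, ?_⟩
    rw [hasFiniteIntegral_iff_ofReal p2, i2]
    exact ENNReal.ofReal_lt_top
  have E2 : ∫ y, y ^ 2 / 2 ∂m = β := by
    rw [integral_eq_lintegral_of_nonneg_ae p2 m2, i2, ENNReal.toReal_ofReal hβ0]
  have E3 : ∫ x in Ioi (0:ℝ), g x * f x = ∫ y, HH g y ∂m := by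
    rw [integral_eq_lintegral_of_nonneg_ae, h.lint hg hf, ← integral_eq_lintegral_of_nonneg_ae]
    · exact h.ae.mono fun y hy => hg.HH_nonneg hy
    · exact hg.HH_cont.aestronglyMeasurable
    · exact hf'.mono fun x hx => mul_nonneg (hg.nn x) hx
    · exact hg.meas.aestronglyMeasurable.mul hint.aestronglyMeasurable
  have I3 : Integrable (HH g) m := by
    refine (I2.const_mul M).mono' hg.HH_cont.aestronglyMeasurable ?_
    filter_upwards [h.ae] with y hy
    rw [Real.norm_eq_abs, abs_of_nonneg (hg.HH_nonneg hy)]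
    have := hg.HH_le hy
    linarith
  rw [E3]
  have I4 : Integrable (fun y : ℝ => z1 + z2 * y + 2 * z3 * (y ^ 2 / 2)) m :=
    ((integrable_const z1).add (I1.const_mul z2)).add (I2.const_mul (2 * z3))
  have hle : ∫ y, HH g y ∂m ≤ ∫ y, (z1 + z2 * y + 2 * z3 * (y ^ 2 / 2)) ∂m := by
    refine integral_mono_ae I3 I4 (h.ae.mono fun y hy => ?_)
    have := hz y hy
    simp only
    linarith
  refine hle.trans ?_
  have I5 : Integrable (fun y : ℝ => z1 + z2 * y) m := (integrable_const z1).add (I1.const_mul z2)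
  rw [integral_add I5 (I2.const_mul (2 * z3)),
    integral_add (integrable_const z1) (I1.const_mul z2), integral_const_mul, integral_const_mul,
    E1, E2, integral_const]
  have hz1 : 0 ≤ z1 := by have := hz 0 le_rfl; rw [HH_zero] at this; linarith
  have : m.real univ ≤ ν := ENNReal.toReal_le_of_le_ofReal hν hm
  have := mul_le_mul_of_nonneg_left this hz1
  rw [smul_eq_mul]
  linarith

lemma dirac_rep (y : ℝ) (hy : 0 ≤ y) : TRep (Measure.dirac y) (fun x => max (y - x) 0) := by
  refine ⟨?_, fun x hx => ?_⟩
  · rw [Measure.dirac_apply' _ measurableSet_Iio]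
    simp [hy]
  · have : ∀ t, Measure.dirac y (Ioi t) = (Iio y).indicator 1 t := by
      intro t
      rw [Measure.dirac_apply' _ measurableSet_Ioi]
      simp [indicator]
    simp_rw [this]
    rw [lintegral_indicator_one measurableSet_Iio, Measure.restrict_apply measurableSet_Iio,
      inter_comm, Ioi_inter_Iio, Real.volume_Ioo]
    rcases le_total (y - x) 0 with h | h
    · rw [max_eq_right h, ENNReal.ofReal_of_nonpos h, ENNReal.ofReal_zero]
    · rw [max_eq_left h]

lemma tent_int {g M} (hg : BM g M) (y : ℝ) (hy : 0 ≤ y) :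
    IntegrableOn (fun x => g x * max (y - x) 0) (Ioi 0) ∧
    ∫ x in Ioi (0:ℝ), g x * max (y - x) 0 = HH g y := by
  have h1 := (dirac_rep y hy).lint hg (fun x _ => le_max_right _ _)
  rw [lintegral_dirac' _ hg.HH_cont.measurable.ennreal_ofReal] at h1
  have hm : AEStronglyMeasurable (fun x => g x * max (y - x) 0) (volume.restrict (Ioi 0)) :=
    (hg.meas.mul ((measurable_const.sub measurable_id).max measurable_const)).aestronglyMeasurable
  have hp : ∀ᵐ x ∂(volume.restrict (Ioi (0:ℝ))), 0 ≤ g x * max (y - x) 0 :=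
    Eventually.of_forall fun x => mul_nonneg (hg.nn x) (le_max_right _ _)
  refine ⟨⟨hm, ?_⟩, ?_⟩
  · rw [hasFiniteIntegral_iff_ofReal hp, h1]
    exact ENNReal.ofReal_lt_top
  · rw [integral_eq_lintegral_of_nonneg_ae hp hm, h1, ENNReal.toReal_ofReal (hg.HH_nonneg hy)]


lemma NI {f : ℝ → ℝ} (hint : IntegrableOn f (Ioi 0)) {δ N : ℝ} (hδ : 0 < δ) (hN : 0 ≤ N)
    (h : ∀ x, N < x → δ ≤ f x) : False := by
  have h1 : IntegrableOn f (Ioi N) := hint.mono_set (Ioi_subset_Ioi hN)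
  have h2 : IntegrableOn (fun _ : ℝ => δ) (Ioi N) := by
    refine Integrable.mono' h1 aestronglyMeasurable_const ?_
    filter_upwards [ae_restrict_mem measurableSet_Ioi] with x hx
    rw [Real.norm_eq_abs, abs_of_pos hδ]; exact h x hx
  rw [integrableOn_const_iff] at h2
  rcases h2 with h2 | h2
  · simp at h2; exact hδ.ne' h2
  · simp at h2

section rep
variable {β η ν : ℝ} {f : ℝ → ℝ}

lemma feas_anti (hf : Feasible 0 β η ν f) {x y : ℝ} (hx : 0 ≤ x) (hxy : x ≤ y) : f y ≤ f x := by
  obtain ⟨hint, -, -, -, -, -, hc, hnn⟩ := hf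
  by_contra hlt
  push Not at hlt
  refine NI hint (δ := f y) (N := y) ((hnn x hx).trans_lt hlt) (hx.trans hxy) fun z hz => ?_
  have := hc.le_max_of_mem_Icc (x := x) (y := z) (z := y) hx (hx.trans (hxy.trans hz.le)) ⟨hxy, hz.le⟩
  rcases le_max_iff.1 this with h | h
  · linarith
  · exact h

lemma feas_tend (hf : Feasible 0 β η ν f) : Tendsto f atTop (𝓝 0) := by
  rw [Metric.tendsto_atTop]
  intro ε hε
  by_contra hcon
  push Not at hcon
  refine NI hf.1 (δ := ε) (N := 0) hε le_rfl fun z hz => ?_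
  obtain ⟨n, hn, h⟩ := hcon z
  have hnn := hf.2.2.2.2.2.2.2
  rw [Real.dist_eq, sub_zero, abs_of_nonneg (hnn n (hz.le.trans hn))] at h
  exact h.trans (feas_anti hf hz.le hn)

lemma feas_deriv (hf : Feasible 0 β η ν f) {x : ℝ} (hx : 0 ≤ x) :
    HasDerivWithinAt f (rightDeriv f x) (Ioi x) x := by
  obtain ⟨hint, -, -, -, hd, -, hc, hnn⟩ := hf
  rcases hx.eq_or_lt with rfl | hx
  · obtain ⟨d, hd⟩ := hd
    exact hd.differentiableWithinAt.hasDerivWithinAt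
  · exact hc.hasDerivWithinAt_rightDeriv_of_mem_interior (by rw [interior_Ici]; exact hx)

lemma feas_d_le (hf : Feasible 0 β η ν f) {x y : ℝ} (hx : 0 ≤ x) (hxy : x < y) :
    rightDeriv f x ≤ slope f x y :=
  hf.2.2.2.2.2.2.1.le_slope_of_hasDerivWithinAt_Ioi hx (hx.trans hxy.le) hxy (feas_deriv hf hx)

lemma feas_le_d (hf : Feasible 0 β η ν f) {x y : ℝ} (hx : 0 ≤ x) (hxy : x < y) :
    slope f x y ≤ rightDeriv f y := by
  have hy : y ∈ interior (Ici (0:ℝ)) := by rw [interior_Ici]; exact hx.trans_lt hxy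
  have hc := hf.2.2.2.2.2.2.1
  exact (hc.slope_le_leftDeriv_of_mem_interior hx hy hxy).trans
    (hc.leftDeriv_le_rightDeriv_of_mem_interior hy)

noncomputable def rr (f : ℝ → ℝ) (x : ℝ) : ℝ := rightDeriv f (max x 0)

lemma rr_mono (hf : Feasible 0 β η ν f) : Monotone (rr f) := by
  intro x y hxy
  have : max x 0 ≤ max y 0 := max_le_max_right 0 hxy
  unfold rr
  rcases this.eq_or_lt with h | h
  · rw [h]
  · exact (feas_d_le hf (le_max_right _ _) h).trans (feas_le_d hf (le_max_right _ _) h)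

lemma rr_nonpos (hf : Feasible 0 β η ν f) (x : ℝ) : rr f x ≤ 0 := by
  have h0 : 0 ≤ max x 0 := le_max_right _ _
  refine (feas_d_le hf h0 (lt_add_one _)).trans ?_
  have := feas_anti hf h0 (lt_add_one (max x 0)).le
  rw [slope_def_field]; simp; linarith

lemma rr_tend (hf : Feasible 0 β η ν f) : Tendsto (rr f) atTop (𝓝 0) := by
  have h1 : Tendsto (fun x => f x - f (x - 1)) atTop (𝓝 0) := by
    have := (feas_tend hf).sub ((feas_tend hf).comp (tendsto_atTop_add_const_right atTop (-1:ℝ) tendsto_id))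
    simpa [sub_eq_add_neg] using this
  refine tendsto_of_tendsto_of_tendsto_of_le_of_le' h1 tendsto_const_nhds ?_
    (Eventually.of_forall (rr_nonpos hf))
  filter_upwards [eventually_ge_atTop 1] with x hx
  have := feas_le_d hf (x := x - 1) (y := x) (by linarith) (by linarith)
  rw [slope_def_field] at this
  simp only [sub_sub_cancel, div_one] at this
  rw [rr, max_eq_left (by linarith)]; exact this

lemma feas_cont (hf : Feasible 0 β η ν f) : ContinuousOn f (Ici 0) := by
  obtain ⟨-, -, -, hc0, -, -, hc, -⟩ := hf
  intro x hx
  rcases (mem_Ici.1 hx).eq_or_lt with rfl | hx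
  · exact hc0
  · have := hc.continuousOn_interior
    rw [interior_Ici] at this
    exact (this.continuousAt (Ioi_mem_nhds hx)).continuousWithinAt

lemma rr_integral (hf : Feasible 0 β η ν f) {x : ℝ} (hx : 0 ≤ x) :
    ENNReal.ofReal (f x) = ∫⁻ t in Ioi x, ENNReal.ofReal (- rr f t) := by
  have hii : ∀ u v, IntervalIntegrable (rr f) volume u v := fun u v =>
    (rr_mono hf).intervalIntegrable
  have hftc : ∀ y, x ≤ y → ∫ t in x..y, rr f t = f y - f x := fun y hy =>
    intervalIntegral.integral_eq_sub_of_hasDeriv_right_of_le hy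
      ((feas_cont hf).mono fun z hz => hx.trans hz.1)
      (fun z hz => by
        have hz0 : 0 ≤ z := hx.trans hz.1.le
        have := feas_deriv hf hz0
        rwa [rr, max_eq_left hz0]) (hii _ _)
  have ht : Tendsto (fun y => ∫ t in x..y, - rr f t) atTop (𝓝 (f x)) := by
    have : Tendsto (fun y => f x - f y) atTop (𝓝 (f x)) := by
      simpa using (tendsto_const_nhds (x := f x)).sub (feas_tend hf)
    refine this.congr' ?_
    filter_upwards [eventually_ge_atTop x] with y hy
    rw [intervalIntegral.integral_neg, hftc y hy]; ring
  have hint : IntegrableOn (fun t => - rr f t) (Ioi x) := by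
    refine integrableOn_Ioi_of_intervalIntegral_norm_tendsto (l := atTop) (b := id) (f x) x ?_ tendsto_id ?_
    · intro y
      rcases le_total x y with h | h
      · exact (intervalIntegrable_iff_integrableOn_Ioc_of_le h).1 (hii x y).neg
      · simp [Ioc_eq_empty_of_le h]
    · convert ht using 4 with y t
      rw [Real.norm_eq_abs, abs_of_nonneg (by linarith [rr_nonpos hf t])]
      rfl
  have := intervalIntegral_tendsto_integral_Ioi x hint tendsto_id
  rw [← tendsto_nhds_unique this ht]
  exact ofReal_integral_eq_lintegral_ofReal hint
    (Eventually.of_forall fun t => by simpa using rr_nonpos hf t)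

lemma rep_exists (hf : Feasible 0 β η ν f) :
    ∃ m : Measure ℝ, IsFiniteMeasure m ∧ m univ ≤ ENNReal.ofReal ν ∧ TRep m f := by
  have hm := rr_mono hf
  set s := hm.stieltjesFunction with hs
  have hst : Tendsto s atTop (𝓝 0) := by
    refine tendsto_of_tendsto_of_tendsto_of_le_of_le (rr_tend hf) tendsto_const_nhds ?_ ?_
    · intro x
      simp only [hs, hm.stieltjesFunction_eq]
      exact hm.le_rightLim le_rfl
    · intro x
      simp only [hs, hm.stieltjesFunction_eq]
      exact (hm.rightLim_le (lt_add_one x)).trans (rr_nonpos hf _)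
  have hIoi : ∀ x, s.measure (Ioi x) = ENNReal.ofReal (- s x) := fun x => by
    rw [s.measure_Ioi hst, zero_sub]
  have hu : (s.measure.restrict (Ioi 0)) univ ≤ ENNReal.ofReal ν := by
    rw [Measure.restrict_apply_univ, hIoi]
    apply ENNReal.ofReal_le_ofReal
    have h1 : rr f 0 ≤ s 0 := by
      simp only [hs, hm.stieltjesFunction_eq]
      exact hm.le_rightLim le_rfl
    have h2 : -ν ≤ rr f 0 := by simpa [rr] using hf.2.2.2.2.2.1
    linarith
  refine ⟨s.measure.restrict (Ioi 0), ⟨hu.trans_lt ENNReal.ofReal_lt_top⟩, hu, ?_, ?_⟩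
  · rw [Measure.restrict_apply measurableSet_Iio]
    convert measure_empty (μ := s.measure)
    ext x; simp; intro h; exact h.le
  · intro x hx
    rw [rr_integral hf hx]
    refine setLIntegral_congr_fun_ae measurableSet_Ioi ?_
    filter_upwards [hm.countable_not_continuousAt.ae_notMem volume] with t ht htx
    rw [Measure.restrict_apply measurableSet_Ioi, inter_eq_left.2 (Ioi_subset_Ioi (hx.trans (le_of_lt htx))), hIoi]
    have hct : ContinuousAt (rr f) t := by simpa using ht
    simp only [hs, hm.stieltjesFunction_eq]
    rw [hct.continuousWithinAt.rightLim_eq]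
end rep


lemma shift_int (a b : ℝ) (f : ℝ → ℝ) :
    ∫ x in Ioi (a - b), f (x + b) = ∫ x in Ioi a, f x := by
  have := (measurePreserving_add_right (volume : Measure ℝ) b).setIntegral_preimage_emb
    (measurableEmbedding_addRight b) f (Ioi a)
  simpa using this

lemma shift_intOn (a b : ℝ) {f : ℝ → ℝ} (hf : IntegrableOn f (Ioi a)) :
    IntegrableOn (fun x => f (x + b)) (Ioi (a - b)) := by
  have := ((measurePreserving_add_right (volume : Measure ℝ) b).integrableOn_comp_preimage
    (measurableEmbedding_addRight b) (f := f) (s := Ioi a)).2 hf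
  simpa [Function.comp_def] using this

lemma shift_deriv (a b d : ℝ) {f : ℝ → ℝ} (hf : HasDerivWithinAt f d (Ioi a) a) :
    HasDerivWithinAt (fun x => f (x + b)) d (Ioi (a - b)) (a - b) := by
  have h1 : HasDerivWithinAt (fun x : ℝ => x + b) 1 (Ioi (a - b)) (a - b) :=
    ((hasDerivAt_id (a - b)).add_const b).hasDerivWithinAt
  have h2 : HasDerivWithinAt f d (Ioi a) ((fun x : ℝ => x + b) (a - b)) := by simpa using hf
  have := h2.comp (a - b) h1 (fun x hx => by simp at hx ⊢; linarith)
  simpa [Function.comp_def] using this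

lemma shift_feas {a β η ν : ℝ} (b : ℝ) {f : ℝ → ℝ} (hf : Feasible a β η ν f) :
    Feasible (a - b) β η ν (fun x => f (x + b)) := by
  obtain ⟨h1, h2, h3, h4, ⟨d, h5⟩, h6, h7, h8⟩ := hf
  refine ⟨shift_intOn a b h1, by rw [shift_int, h2], by simpa using h3, ?_, ⟨d, shift_deriv a b d h5⟩,
    ?_, ?_, fun x hx => h8 _ (by linarith)⟩
  · have h4' : ContinuousWithinAt f (Ici a) (a - b + b) := by simpa using h4
    exact h4'.comp (f := fun x : ℝ => x + b) (by fun_prop) (fun x hx => by simp at hx ⊢; linarith)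
  · unfold rightDeriv at h6 ⊢
    rw [h5.derivWithin (uniqueDiffWithinAt_Ioi a)] at h6
    rwa [(shift_deriv a b d h5).derivWithin (uniqueDiffWithinAt_Ioi _)]
  · refine ⟨convex_Ici _, fun x hx y hy p q hp hq hpq => ?_⟩
    have := h7.2 (x := x + b) (by simp at hx ⊢; linarith) (y := y + b) (by simp at hy ⊢; linarith) hp hq hpq
    convert this using 2
    simp only [smul_eq_mul]
    linear_combination (-b) * hpq

lemma tent_deriv {y : ℝ} (hy : 0 ≤ y) :
    ∃ d, -1 ≤ d ∧ HasDerivWithinAt (fun x => max (y - x) 0) d (Ioi 0) 0 := by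
  rcases hy.eq_or_lt with rfl | hy
  · refine ⟨0, by norm_num, (hasDerivWithinAt_const (0:ℝ) (Ioi 0) (0:ℝ)).congr ?_ (by simp)⟩
    intro x hx; simp at hx ⊢; exact hx.le
  · refine ⟨-1, le_rfl, HasDerivAt.hasDerivWithinAt ?_⟩
    have : HasDerivAt (fun x : ℝ => y - x) (-1) 0 := by simpa using (hasDerivAt_id (0:ℝ)).const_sub y
    refine this.congr_of_eventuallyEq ?_
    filter_upwards [Iio_mem_nhds hy] with x hx
    simp at hx ⊢; exact hx.le

lemma tent_convex (y : ℝ) : ConvexOn ℝ (Ici 0) (fun x : ℝ => max (y - x) 0) := by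
  have h1 : ConvexOn ℝ (Ici 0) (fun x : ℝ => y - x) :=
    (convexOn_const y (convex_Ici 0)).sub (concaveOn_id (convex_Ici 0))
  exact h1.sup (convexOn_const 0 (convex_Ici 0))

noncomputable def pf (μ σ ν t x : ℝ) : ℝ :=
  ν * ((σ - μ ^ 2) / (σ - 2 * μ * t + t ^ 2) * max (t - x) 0 +
    (μ - t) ^ 2 / (σ - 2 * μ * t + t ^ 2) * max (x2 μ σ t - x) 0)

lemma pf_int {g M} (hg : BM g M) {μ σ ν t : ℝ} (hs : μ ^ 2 < σ) (h0 : 0 ≤ t) (ht : t < μ) (lam : ℝ) :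
    IntegrableOn (fun x => g x * pf μ σ ν t x) (Ioi 0) ∧
    ∫ x in Ioi 0, g x * pf μ σ ν t x = ν * ww μ σ lam g t := by
  obtain ⟨i1, e1⟩ := tent_int hg t h0
  obtain ⟨i2, e2⟩ := tent_int hg (x2 μ σ t) ((h0.trans ht.le).trans (x2_gt hs ht).le)
  set p1 := (σ - μ ^ 2) / (σ - 2 * μ * t + t ^ 2) with hp1
  set p2 := (μ - t) ^ 2 / (σ - 2 * μ * t + t ^ 2) with hp2
  have e : (fun x => g x * pf μ σ ν t x) = fun x => (ν * p1) * (g x * max (t - x) 0) +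
      (ν * p2) * (g x * max (x2 μ σ t - x) 0) := by
    funext x; unfold pf; rw [← hp1, ← hp2]; ring
  rw [e]
  refine ⟨(i1.const_mul _).add (i2.const_mul _), ?_⟩
  rw [integral_add (i1.const_mul _) (i2.const_mul _), integral_const_mul, integral_const_mul, e1, e2,
    ww, if_neg ht.ne, ← hp1, ← hp2]
  ring

lemma pf_feas {μ σ ν t : ℝ} (hν : 0 < ν) (hs : μ ^ 2 < σ) (h0 : 0 ≤ t) (ht : t < μ) :
    Feasible 0 (ν * σ / 2) (ν * μ) ν (pf μ σ ν t) := by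
  have hx2 : 0 ≤ x2 μ σ t := (h0.trans ht.le).trans (x2_gt hs ht).le
  obtain ⟨i, e⟩ := pf_int (ν := ν) const_BM hs h0 ht 0
  have m0 := two_point hs ht 1 0 0
  have m1 := two_point hs ht 0 1 0
  have m2 := two_point hs ht 0 0 1
  simp only [one_mul] at i e
  rw [ww, if_neg ht.ne, const_HH, const_HH] at e
  obtain ⟨d1, hd1, D1⟩ := tent_deriv h0
  obtain ⟨d2, hd2, D2⟩ := tent_deriv hx2
  have q1 : 0 ≤ (σ - μ ^ 2) / (σ - 2 * μ * t + t ^ 2) := div_nonneg (by linarith) (den_pos hs t).le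
  have q2 : 0 ≤ (μ - t) ^ 2 / (σ - 2 * μ * t + t ^ 2) := div_nonneg (sq_nonneg _) (den_pos hs t).le
  have hdef : pf μ σ ν t = fun x => ν * ((σ - μ ^ 2) / (σ - 2 * μ * t + t ^ 2) * max (t - x) 0 +
    (μ - t) ^ 2 / (σ - 2 * μ * t + t ^ 2) * max (x2 μ σ t - x) 0) := rfl
  set p1 := (σ - μ ^ 2) / (σ - 2 * μ * t + t ^ 2) with hp1
  set p2 := (μ - t) ^ 2 / (σ - 2 * μ * t + t ^ 2) with hp2
  have D : HasDerivWithinAt (pf μ σ ν t) (ν * (p1 * d1 + p2 * d2)) (Ioi 0) 0 := by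
    rw [hdef]
    exact ((D1.const_mul p1).add (D2.const_mul p2)).const_mul ν
  refine ⟨i, ?_, ?_, ?_, ⟨_, D⟩, ?_, ?_, ?_⟩
  · rw [e]; linear_combination (ν / 2) * m2
  · rw [hdef]; simp only [sub_zero, max_eq_left h0, max_eq_left hx2]; linear_combination ν * m1
  · rw [hdef]; fun_prop
  · rw [rightDeriv, D.derivWithin (uniqueDiffWithinAt_Ioi _)]
    have : -1 ≤ p1 * d1 + p2 * d2 := by nlinarith
    nlinarith
  · rw [hdef]
    exact (((tent_convex t).smul q1).add ((tent_convex _).smul q2)).smul hν.le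
  · intro x _
    rw [hdef]
    have := le_max_right (t - x) 0
    have := le_max_right (x2 μ σ t - x) 0
    positivity

theorem worstcase_value_eq_line_search
    (a β η ν : ℝ) (hβ : 0 < β) (hη : 0 < η) (hν : 0 < ν)
    (hcond : η ^ 2 < 2 * β * ν)
    (h : ℝ → ℝ) (hbd : ∃ M, ∀ x, |h x| ≤ M) (hpos : ∀ x, 0 ≤ h x)
    (hquasi : ∃ c : EReal, (a : EReal) ≤ c ∧
      MonotoneOn h {x : ℝ | a ≤ x ∧ (x : EReal) < c} ∧
      AntitoneOn h {x : ℝ | c < (x : EReal)})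
    (lam : ℝ) (hlam : Tendsto (fun x => Hfun a h x / x ^ 2) atTop (𝓝 lam))
    (μ σ : ℝ) (hμ : μ = η / ν) (hσ : σ = 2 * β / ν) :
    sSup {z : ℝ | ∃ f : ℝ → ℝ, Feasible a β η ν f ∧
      z = ∫ x in Set.Ioi a, h x * f x} =
    sSup ((Wfun a ν μ σ lam h) '' Set.Icc 0 μ) := by
  obtain ⟨M, hM⟩ := hbd
  have hM' : ∀ x, h x ≤ M := fun x => (le_abs_self _).trans (hM x)
  obtain ⟨c, hac, h1, h2⟩ := hquasi
  have hc : c ≠ ⊥ := by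
    rintro rfl
    simp at hac
  have hμ0 : 0 < μ := by rw [hμ]; positivity
  have eη : η = ν * μ := by rw [hμ]; field_simp
  have eβ : β = ν * σ / 2 := by rw [hσ]; field_simp
  have hs : μ ^ 2 < σ := by
    rw [eη, eβ] at hcond
    have : ν ^ 2 * μ ^ 2 < ν ^ 2 * σ := by nlinarith
    exact lt_of_mul_lt_mul_left this (by positivity)
  set g : ℝ → ℝ := fun v => h (v + a) with hg
  set G : ℝ → ℝ := fun v => if 0 < v then h (v + a) else 0 with hG
  have hM0 : 0 ≤ M := (hpos 0).trans (hM' 0)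
  have hGB : BM G M := ⟨meas_pos a M h hM' hpos c h1 h2,
    fun x => by simp only [hG]; split_ifs; exacts [hpos _, le_rfl],
    fun x => by simp only [hG]; split_ifs; exacts [hM' _, hM0]⟩
  have hHH : ∀ x, 0 ≤ x → HH G x = HH g x := fun x hx =>
    HH_congr (Eventually.of_forall fun v hv => by simp [hG, hg, hv]) hx
  have hlamg : Tendsto (fun x => HH g x / x ^ 2) atTop (𝓝 lam) := hlam
  have hlamG : Tendsto (fun x => HH G x / x ^ 2) atTop (𝓝 lam) := by
    refine hlamg.congr' ?_
    filter_upwards [eventually_ge_atTop 0] with x hx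
    rw [hHH x hx]
  have hww : ∀ t ∈ Icc 0 μ, ww μ σ lam G t = ww μ σ lam g t := by
    intro t ht
    unfold ww
    split_ifs with htm
    · rw [hHH _ hμ0.le]
    · have htl := lt_of_le_of_ne ht.2 htm
      rw [hHH _ ht.1, hHH _ (hμ0.le.trans (x2_gt hs htl).le)]
  have himg : (Wfun a ν μ σ lam h) '' Set.Icc 0 μ = (fun t => ν * ww μ σ lam G t) '' Set.Icc 0 μ := by
    refine image_congr fun t ht => ?_
    rw [Wfun_eq, hww t ht]
  rw [himg]
  have hbdd : BddAbove ((fun t => ν * ww μ σ lam G t) '' Set.Icc 0 μ) :=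
    (isCompact_Icc.image_of_continuousOn (continuousOn_const.mul (ww_contOn hGB hs hlamG))).bddAbove
  have hval : ∀ f : ℝ → ℝ, ∫ x in Ioi a, h x * f x = ∫ x in Ioi 0, G x * f (x + a) := by
    intro f
    rw [← shift_int a a (fun x => h x * f x), sub_self]
    refine setIntegral_congr_fun measurableSet_Ioi fun x hx => ?_
    have : 0 < x := hx
    simp [hG, this]
  have hub : ∀ f, Feasible a β η ν f → ∫ x in Ioi a, h x * f x ≤
      sSup ((fun t => ν * ww μ σ lam G t) '' Set.Icc 0 μ) := by
    intro f hf
    have hf0 := shift_feas a hf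
    rw [sub_self] at hf0
    rw [hval]
    obtain ⟨m, hmf, hmu, hrep⟩ := rep_exists hf0
    have hνσ : 0 < ν * (σ / 2) := by have := sq_nonneg μ; exact mul_pos hν (by linarith)
    refine le_of_forall_pos_le_add fun δ hδ => ?_
    obtain ⟨t, ht, z1, z2, z3, hz, hzle⟩ := dual_approx (a := a) hM' hpos hc h1 h2 hμ0 hs hlamg
      (ε := δ / (ν * (σ / 2))) (div_pos hδ hνσ)
    have hw := hrep.weak hGB hf0.2.2.2.2.2.2.2 hν.le hmu hf0.1 hf0.2.1 hf0.2.2.1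
      (fun x hx => (hHH x hx).le.trans (hz x hx))
    have hmem := le_csSup hbdd (mem_image_of_mem (fun t => ν * ww μ σ lam G t) ht)
    simp only [hww t ht] at hmem
    have h3 := mul_le_mul_of_nonneg_left hzle hν.le
    have h4 : ν * (δ / (ν * (σ / 2)) * (σ / 2)) = δ := by
      have : σ ≠ 0 := by rintro rfl; simp at hνσ
      field_simp
    rw [mul_add ν (ww μ σ lam (fun v => h (v + a)) t), h4] at h3
    calc _ ≤ _ := hw
      _ = ν * (z1 + z2 * μ + z3 * σ) := by rw [eη, eβ]; ring
      _ ≤ _ := h3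
      _ ≤ _ := by gcongr
  have hset : BddAbove {z : ℝ | ∃ f : ℝ → ℝ, Feasible a β η ν f ∧ z = ∫ x in Set.Ioi a, h x * f x} :=
    ⟨_, by rintro _ ⟨f, hf, rfl⟩; exact hub f hf⟩
  have hlow : ∀ t, 0 ≤ t → t < μ → ν * ww μ σ lam G t ∈
      {z : ℝ | ∃ f : ℝ → ℝ, Feasible a β η ν f ∧ z = ∫ x in Set.Ioi a, h x * f x} := by
    intro t h0 ht
    have hf := shift_feas (-a) (pf_feas hν hs h0 ht)
    rw [← eη, ← eβ, zero_sub, neg_neg] at hf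
    refine ⟨_, hf, ?_⟩
    rw [hval, ← (pf_int (ν := ν) hGB hs h0 ht lam).2]
    simp
  apply le_antisymm
  · refine csSup_le ⟨_, hlow 0 le_rfl hμ0⟩ ?_
    rintro _ ⟨f, hf, rfl⟩
    exact hub f hf
  · refine csSup_le ⟨_, mem_image_of_mem _ (left_mem_Icc.2 hμ0.le)⟩ ?_
    rintro _ ⟨t, ht, rfl⟩
    rcases ht.2.eq_or_lt with rfl | htm
    · refine le_of_tendsto ((ww_tendsto hGB hs hlamG).const_mul ν) ?_
      filter_upwards [Ioo_mem_nhdsLT hμ0] with u hu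
      exact le_csSup hset (hlow u hu.1.le hu.2)
    · exact le_csSup hset (hlow t ht.1 htm)
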